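/- arXiv:math/0611866 — 4 statements merged into one kernel-verified Lean document; each statement's English description precedes it below -/
import Mathlib

section
/- Let M be a symmetric 3×3 real matrix and, for y > 0 and θ ∈ ℝ, let A(y,θ) be the 3×3 real matrix with rows (cos θ / y, −sin θ / y, 0), (sin θ / y, cos θ / y, 0), (0, 1/y, 1). Then the map θ ↦ A(y,θ)ᵀ · M · A(y,θ) is constant in θ for every y > 0 if and only if there exist real numbers c, w such that M = diag(c, c, w); and in that case, for all y > 0 and θ ∈ ℝ, A(y,θ)ᵀ · M · A(y,θ) is the matrix with rows (c·y⁻², 0, 0), (0, (c+w)·y⁻², w·y⁻¹), (0, w·y⁻¹, w). -/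
open Real Matrix

/-- The change-of-basis matrix from the left-invariant frame `(L_α, L_λ, L_κ)` on
`PSL₂(ℝ)` to the coordinate frame `(∂/∂y, ∂/∂x, ∂/∂θ)` in Iwasawa coordinates. -/
noncomputable def iwasawaFrameMatrix (y θ : ℝ) : Matrix (Fin 3) (Fin 3) ℝ :=
  !![Real.cos θ / y, -Real.sin θ / y, 0;
     Real.sin θ / y,  Real.cos θ / y, 0;
     0,               1 / y,          1]

theorem iwasawaFrameMatrix_conj_diagonal (c w : ℝ) {y : ℝ} (hy : y ≠ 0) (θ : ℝ) :
    (iwasawaFrameMatrix y θ)ᵀ * !![c, 0, 0; 0, c, 0; 0, 0, w] * iwasawaFrameMatrix y θ =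
      !![c * (y ^ 2)⁻¹, 0,                 0;
         0,             (c + w) * (y ^ 2)⁻¹, w * y⁻¹;
         0,             w * y⁻¹,             w] := by
  have h := Real.sin_sq_add_cos_sq θ
  ext i j
  fin_cases i <;> fin_cases j <;>
    simp [iwasawaFrameMatrix, Matrix.mul_apply, Fin.sum_univ_three] <;>
    field_simp <;> grind

theorem eq_diagonal_of_iwasawaFrameMatrix_conj_const {M : Matrix (Fin 3) (Fin 3) ℝ}
    (hM : M.IsSymm)
    (h : ∀ θ₁ θ₂ : ℝ,
      (iwasawaFrameMatrix 1 θ₁)ᵀ * M * iwasawaFrameMatrix 1 θ₁ =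
      (iwasawaFrameMatrix 1 θ₂)ᵀ * M * iwasawaFrameMatrix 1 θ₂) :
    M = !![M 0 0, 0, 0; 0, M 0 0, 0; 0, 0, M 2 2] := by
  have h02 := congrFun₂ (h 0 π) 0 2
  have h12 := congrFun₂ (h 0 π) 1 2
  have h00 := congrFun₂ (h 0 (π / 2)) 0 0
  have h01 := congrFun₂ (h 0 (π / 2)) 0 1
  simp [iwasawaFrameMatrix, Matrix.mul_apply, Fin.sum_univ_three] at h02 h12 h00 h01
  have s01 := hM.apply 0 1
  have s02 := hM.apply 0 2
  have s12 := hM.apply 1 2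
  ext i j
  fin_cases i <;> fin_cases j <;> simp <;> linarith

/-- Classification of left-invariant, circle-invariant Riemannian metrics on `PSL₂(ℝ)`:
a symmetric matrix `M` conjugated by the Iwasawa frame matrix gives a result independent of
`θ` (for all `y > 0`) iff `M = diag (c, c, w)`, and in that case the conjugated matrix has
the explicit quasi-hyperbolic form. -/
theorem circle_invariant_metrics_classification (M : Matrix (Fin 3) (Fin 3) ℝ)
    (hM : M.IsSymm) :
    ((∀ y : ℝ, 0 < y → ∀ θ₁ θ₂ : ℝ,
        (iwasawaFrameMatrix y θ₁)ᵀ * M * iwasawaFrameMatrix y θ₁ =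
        (iwasawaFrameMatrix y θ₂)ᵀ * M * iwasawaFrameMatrix y θ₂) ↔
      (∃ c w : ℝ, M = !![c, 0, 0; 0, c, 0; 0, 0, w])) ∧
    (∀ c w : ℝ, M = !![c, 0, 0; 0, c, 0; 0, 0, w] →
      ∀ y : ℝ, 0 < y → ∀ θ : ℝ,
        (iwasawaFrameMatrix y θ)ᵀ * M * iwasawaFrameMatrix y θ =
        !![c * (y ^ 2)⁻¹, 0,                 0;
           0,             (c + w) * (y ^ 2)⁻¹, w * y⁻¹;
           0,             w * y⁻¹,             w]) := by
  refine ⟨⟨fun h => ⟨M 0 0, M 2 2,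
    eq_diagonal_of_iwasawaFrameMatrix_conj_const hM (h 1 one_pos)⟩, ?_⟩, ?_⟩
  · rintro ⟨c, w, rfl⟩ y hy θ₁ θ₂
    rw [iwasawaFrameMatrix_conj_diagonal c w hy.ne', iwasawaFrameMatrix_conj_diagonal c w hy.ne']
  · rintro c w rfl y hy θ
    exact iwasawaFrameMatrix_conj_diagonal c w hy.ne' θ
end

section
/- Let c′, c″, κ be real constants and let x, y : ℝ → ℝ be differentiable functions satisfying, for all s, x′(s) = c′·y(s)² − κ·y(s) and y′(s) = (c″ − c′·x(s))·y(s). Then the function s ↦ (c′·x(s) − c″)² + (c′·y(s) − κ)² is constant on ℝ. -/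
/-- Conservation law (15) for the projection to the hyperbolic plane of a geodesic of
`PSL₂(ℝ)`: the quantity `(c′x − c″)² + (c′y − κ)²` (the hyperbolic speed squared) is
constant along the motion. -/
theorem geodesic_projection_speed_constant (c' c'' κ : ℝ) (x y : ℝ → ℝ)
    (hx : Differentiable ℝ x) (hy : Differentiable ℝ y)
    (hx' : ∀ s, deriv x s = c' * (y s) ^ 2 - κ * y s)
    (hy' : ∀ s, deriv y s = (c'' - c' * x s) * y s) :
    ∀ s t : ℝ, (c' * x s - c'') ^ 2 + (c' * y s - κ) ^ 2
      = (c' * x t - c'') ^ 2 + (c' * y t - κ) ^ 2 := by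
  have hderiv : ∀ s, HasDerivAt
      (fun s => (c' * x s - c'') ^ 2 + (c' * y s - κ) ^ 2) 0 s := by
    intro s
    have h := ((((hx s).hasDerivAt.const_mul c').sub_const c'').pow 2).add
      ((((hy s).hasDerivAt.const_mul c').sub_const κ).pow 2)
    rw [hx', hy'] at h
    refine h.congr_deriv ?_
    push_cast
    ring
  exact is_const_of_deriv_eq_zero (fun s => (hderiv s).differentiableAt)
    fun s => (hderiv s).deriv
end

section
/- Let C > 0, k ∈ (−1, 1) and s₀ ∈ ℝ. Define φ : ℝ → ℝ by φ(s) = 2·arctan( √((1 + k)/(1 − k)) · tanh( C·√(1 − k²)·(s − s₀)/2 ) ). Then φ is differentiable and φ′(s) = C·(k + cos φ(s)) for every s ∈ ℝ. -/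
theorem Real.hasDerivAt_tanh_one_sub_sq (x : ℝ) :
    HasDerivAt Real.tanh (1 - Real.tanh x ^ 2) x := by
  have hc : Real.cosh x ≠ 0 := (Real.cosh_pos x).ne'
  have h := (Real.hasDerivAt_sinh x).div (Real.hasDerivAt_cosh x) hc
  have hfun : Real.tanh = Real.sinh / Real.cosh := by
    funext y
    exact Real.tanh_eq_sinh_div_cosh y
  rw [← hfun] at h
  refine h.congr_deriv ?_
  rw [Real.tanh_eq_sinh_div_cosh]
  field_simp

theorem Real.cos_two_mul_arctan_eq (x : ℝ) :
    Real.cos (2 * Real.arctan x) = 2 / (1 + x ^ 2) - 1 := by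
  rw [Real.cos_two_mul, Real.cos_sq_arctan]
  ring

theorem Real.sqrt_div_mul_sqrt_one_sub_sq {k : ℝ} (hk : k ∈ Set.Ioo (-1 : ℝ) 1) :
    Real.sqrt ((1 + k) / (1 - k)) * Real.sqrt (1 - k ^ 2) = 1 + k := by
  have h₁ : 0 < 1 + k := by linarith [hk.1]
  have h₂ : 0 < 1 - k := by linarith [hk.2]
  rw [← Real.sqrt_mul (by positivity), ← Real.sqrt_sq h₁.le]
  congr 1
  rw [Real.sqrt_sq h₁.le]
  field_simp
  ring

/-- Explicit solution of the geodesic angle ODE `φ̇ = C (k + cos φ)` in the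
quasi-geodesic case `|k| < 1` (Section 7.1 of the paper). -/
theorem geodesic_angle_ode_solution_quasigeodesic (C k s₀ : ℝ) (hC : 0 < C)
    (hk : k ∈ Set.Ioo (-1 : ℝ) 1)
    (φ : ℝ → ℝ)
    (hφ : φ = fun s => 2 * Real.arctan
      (Real.sqrt ((1 + k) / (1 - k)) * Real.tanh (C * Real.sqrt (1 - k ^ 2) * (s - s₀) / 2))) :
    Differentiable ℝ φ ∧ ∀ s, deriv φ s = C * (k + Real.cos (φ s)) := by
  have h₁ : 0 < 1 + k := by linarith [hk.1]
  have h₂ : 0 < 1 - k := by linarith [hk.2]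
  have hφ' : ∀ s, HasDerivAt φ (C * (k + Real.cos (φ s))) s := by
    intro s
    have hprod := Real.sqrt_div_mul_sqrt_one_sub_sq hk
    have hsq : Real.sqrt ((1 + k) / (1 - k)) ^ 2 * (1 - k) = 1 + k := by
      rw [Real.sq_sqrt (by positivity)]
      field_simp
    subst hφ
    set r := Real.sqrt ((1 + k) / (1 - k))
    set w := Real.sqrt (1 - k ^ 2)
    have hlin : HasDerivAt (fun s => C * w * (s - s₀) / 2) (C * w * 1 / 2) s :=
      (((hasDerivAt_id s).sub_const s₀).const_mul (C * w)).div_const 2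
    have h := ((((Real.hasDerivAt_tanh_one_sub_sq _).comp s hlin).const_mul r).arctan).const_mul 2
    refine h.congr_deriv ?_
    simp only [Function.comp_apply, Real.cos_two_mul_arctan_eq]
    set t := Real.tanh (C * w * (s - s₀) / 2)
    have hpos : 1 + (r * t) ^ 2 ≠ 0 := by positivity
    field_simp
    linear_combination (1 - t ^ 2) * hprod + t ^ 2 * hsq
  exact ⟨fun s => (hφ' s).differentiableAt, fun s => (hφ' s).deriv⟩
end

section
/- Let C ∈ ℝ, k ∈ (−1, 1), and let φ : I → ℝ be a differentiable function on an open interval I such that φ′(s) = C·(k + cos φ(s)) and k + cos φ(s) > 0 for all s ∈ I. Define α : I → ℝ by α(s) = arctan( √(1 − k²)·sin φ(s) / (k + cos φ(s)) ). Then α is differentiable and α′(s) = C·√(1 − k²)·cos α(s) for all s ∈ I. -/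
open Real

/-- The secant identity behind the projection angle: if `tan α = √(1 − k²) sin x / (k + cos x)`
then `sec² α = ((1 + k cos x) / (k + cos x))²`. -/
lemma one_add_sq_projection_tan {k x : ℝ} (hk : k ∈ Set.Ioo (-1 : ℝ) 1)
    (hx : k + Real.cos x ≠ 0) :
    1 + (Real.sqrt (1 - k ^ 2) * Real.sin x / (k + Real.cos x)) ^ 2 =
      ((1 + k * Real.cos x) / (k + Real.cos x)) ^ 2 := by
  have hr : Real.sqrt (1 - k ^ 2) ^ 2 = 1 - k ^ 2 :=
    Real.sq_sqrt (by nlinarith [hk.1, hk.2])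
  rw [div_pow, mul_pow, hr, Real.sin_sq, div_pow]
  field_simp
  ring

lemma one_add_mul_cos_pos {k : ℝ} (hk : k ∈ Set.Ioo (-1 : ℝ) 1) (x : ℝ) :
    0 < 1 + k * Real.cos x := by
  have h : |k * Real.cos x| < 1 := by
    rw [abs_mul]
    exact (mul_le_of_le_one_right (abs_nonneg k) (Real.abs_cos_le_one x)).trans_lt (abs_lt.2 hk)
  linarith [(abs_lt.1 h).1]

lemma cos_arctan_projection_tan {k x : ℝ} (hk : k ∈ Set.Ioo (-1 : ℝ) 1)
    (hx : 0 < k + Real.cos x) :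
    Real.cos (Real.arctan (Real.sqrt (1 - k ^ 2) * Real.sin x / (k + Real.cos x))) =
      (k + Real.cos x) / (1 + k * Real.cos x) := by
  have h := one_add_mul_cos_pos hk x
  rw [Real.cos_arctan, one_add_sq_projection_tan hk hx.ne', Real.sqrt_sq (by positivity),
    one_div_div]

/-- Remark 7.1 of the paper: if `φ` solves `φ̇ = C (k + cos φ)` with `k + cos φ > 0` on an
open interval, then the angular coordinate `α = arctan(√(1 − k²) sin φ / (k + cos φ))` of
the orthogonal projection onto the associated geodesic satisfies
`α̇ = C √(1 − k²) cos α` (constant hyperbolic speed `C √(1 − k²)`). -/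
theorem projection_angle_ode (C : ℝ) (k : ℝ) (hk : k ∈ Set.Ioo (-1 : ℝ) 1)
    (a b : ℝ) (φ : ℝ → ℝ)
    (hφ : ∀ s ∈ Set.Ioo a b, HasDerivAt φ (C * (k + Real.cos (φ s))) s)
    (hpos : ∀ s ∈ Set.Ioo a b, 0 < k + Real.cos (φ s))
    (α : ℝ → ℝ)
    (hα : α = fun s => Real.arctan
      (Real.sqrt (1 - k ^ 2) * Real.sin (φ s) / (k + Real.cos (φ s)))) :
    ∀ s ∈ Set.Ioo a b,
      HasDerivAt α (C * Real.sqrt (1 - k ^ 2) * Real.cos (α s)) s := by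
  intro s hs
  have hφs := hφ s hs
  have hx := hpos s hs
  have hd := one_add_mul_cos_pos hk (φ s)
  subst hα
  convert ((hφs.sin.const_mul (Real.sqrt (1 - k ^ 2))).fun_div (hφs.cos.const_add k) hx.ne').arctan
    using 1
  rw [cos_arctan_projection_tan hk hx, one_add_sq_projection_tan hk hx.ne']
  field_simp
  linear_combination (-(C * Real.sqrt (1 - k ^ 2))) * Real.sin_sq_add_cos_sq (φ s)
end
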